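/- arXiv:1807.11295 — 11 statements merged into one kernel-verified Lean document; each statement's English description precedes it below -/
import Mathlib

section
/- Let p be a prime and B̃ a commutative ring in which (p : B̃)² = 0. Let Ã be a commutative ring and let f₁, f₂ : Ã → B̃ be ring homomorphisms that agree modulo p, i.e., f₁(a) − f₂(a) ∈ p·B̃ for every a ∈ Ã. Then f₁(x) = f₂(x) for every x ∈ Ã of the form x = z^p + p·c with z, c ∈ Ã. (This is the affine core of the paper's fundamental lemma that any two liftings modulo p² of a morphism of smooth schemes induce the same map on the subsheaves of relative Witt vectors, i.e., agree on functions whose reduction mod p is a p-th power up to p-multiples.) -/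
/-- Let `p` be a prime and `B` a commutative ring in which `(p : B)² = 0`.  Let `A` be a
commutative ring and `f₁ f₂ : A → B` ring homomorphisms that agree modulo `p`, i.e.
`f₁ a − f₂ a ∈ p·B` for every `a`.  Then `f₁ x = f₂ x` for every `x ∈ A` of the form
`x = z ^ p + p·c` with `z c ∈ A`.  (Affine core of the fundamental lemma: two liftings
modulo `p²` of a morphism of smooth schemes agree on relative Witt vectors.) -/
theorem ringHom_congr_mod_p_of_pow_add_p_mul
    (p : ℕ) (hp : p.Prime) (A B : Type*) [CommRing A] [CommRing B]
    (hB : (p : B) ^ 2 = 0)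
    (f₁ f₂ : A →+* B) (hf : ∀ a : A, ∃ d : B, f₁ a - f₂ a = p * d)
    (x z c : A) (hx : x = z ^ p + p * c) :
    f₁ x = f₂ x := by
  have hz : f₁ z ^ p = f₂ z ^ p := by
    have h := dvd_sub_pow_of_dvd_sub (hf z) 1
    rw [one_add_one_eq_two, hB, zero_dvd_iff, pow_one] at h
    exact sub_eq_zero.mp h
  have hc : (p : B) * f₁ c = p * f₂ c := by
    obtain ⟨d, hd⟩ := hf c
    rw [← sub_eq_zero, ← mul_sub, hd, ← mul_assoc, ← pow_two, hB, zero_mul]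
  rw [hx, map_add, map_add, map_pow, map_pow, map_mul, map_mul, map_natCast, map_natCast, hz, hc]
end

section
/- Let p be a prime, B̃ a commutative ring with (p : B̃)² = 0 which is flat over Z/p²Z (every b ∈ B̃ with p·b = 0 lies in p·B̃), and F̃ : B̃ → B̃ a Frobenius lift, i.e., a ring endomorphism with F̃(b) − b^p ∈ p·B̃ for all b. Write B = B̃/p·B̃ with quotient map π. Then there exists a unique ring homomorphism τ : B̃ → W₂(B) into the ring of p-typical Witt vectors of length 2 over B such that for every b ∈ B̃: the coefficient (τ b)₀ equals π(b), and for every c ∈ B̃ with π(c) = (τ b)₁ one has F̃(b) − b^p = p·c. (This is the Cartier morphism t(F̃) associated to a Frobenius lifting, b ↦ (b mod p, δ(b)) where F̃(b) = b^p + p·δ̃(b).) -/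
/-- Two Witt vectors over a ring flat modulo `p²` with the same first two ghost components have the
same image in the length-two Witt vectors over the reduction modulo `p`. -/
theorem truncate_map_mk_eq_of_ghostComponent_eq {p : ℕ} [Fact p.Prime] {B : Type*} [CommRing B]
    (hflat : ∀ b : B, (p : B) * b = 0 → ∃ c : B, b = p * c) {x y : WittVector p B}
    (h0 : WittVector.ghostComponent 0 x = WittVector.ghostComponent 0 y)
    (h1 : WittVector.ghostComponent 1 x = WittVector.ghostComponent 1 y) :
    WittVector.truncate 2 (WittVector.map (Ideal.Quotient.mk (Ideal.span {(p : B)})) x) =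
      WittVector.truncate 2 (WittVector.map (Ideal.Quotient.mk (Ideal.span {(p : B)})) y) := by
  simp only [WittVector.ghostComponent_apply, wittPolynomial_zero, wittPolynomial_one, map_add,
    map_mul, map_pow, MvPolynomial.aeval_X, map_natCast] at h0 h1
  have h : (p : B) * (x.coeff 1 - y.coeff 1) = 0 := by
    rw [h0] at h1
    linear_combination h1
  obtain ⟨c, hc⟩ := hflat _ h
  ext i
  rw [WittVector.coeff_truncate, WittVector.coeff_truncate, WittVector.map_coeff,
    WittVector.map_coeff]
  fin_cases i
  · exact congrArg _ h0
  · exact Ideal.Quotient.eq.2 (Ideal.mem_span_singleton.2 ⟨c, hc⟩)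

/-- Elements congruent modulo `p` have the same product with `p` when `p² = 0`. -/
theorem mul_eq_mul_of_mk_span_eq {B : Type*} [CommRing B] {p : B} (hp2 : p ^ 2 = 0) {c d : B}
    (h : Ideal.Quotient.mk (Ideal.span {p}) c = Ideal.Quotient.mk (Ideal.span {p}) d) :
    p * c = p * d := by
  obtain ⟨e, he⟩ := Ideal.mem_span_singleton.1 (Ideal.Quotient.eq.1 h)
  linear_combination p * he + e * hp2


/-- Let `p` be a prime, `B` a commutative ring with `(p : B)² = 0` which is flat over
`ℤ/p²ℤ` (every element killed by `p` is a multiple of `p`), and `F : B → B` a Frobenius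
lift, i.e. a ring endomorphism with `F b − b^p ∈ p·B` for all `b`.
Then there is a unique ring homomorphism `τ : B → W₂(B/pB)` into the length-two `p`-typical
Witt vectors over `B/pB` such that for every `b`, the 0-th coefficient of `τ b` is `b mod p`,
and for every `c ∈ B` reducing to the 1-st coefficient of `τ b` one has
`F b − b^p = p·c`.  (This is the Cartier morphism `t(F̃)` of a Frobenius lifting,
`b ↦ (b mod p, δ(b))` where `F̃ b = b^p + p·δ(b)`.) -/
theorem exists_unique_cartier_map_of_frobenius_lift
    (p : ℕ) [Fact p.Prime] (B : Type*) [CommRing B]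
    (hp2 : (p : B) ^ 2 = 0)
    (hflat : ∀ b : B, (p : B) * b = 0 → ∃ c : B, b = p * c)
    (F : B →+* B) (hF : ∀ b : B, ∃ c : B, F b - b ^ p = p * c) :
    ∃! τ : B →+* TruncatedWittVector p 2 (B ⧸ Ideal.span {(p : B)}),
      ∀ b : B,
        (τ b).coeff 0 = Ideal.Quotient.mk (Ideal.span {(p : B)}) b ∧
        ∀ c : B, Ideal.Quotient.mk (Ideal.span {(p : B)}) c = (τ b).coeff 1 →
          F b - b ^ p = p * c := by
  choose δ hδ using hF
  let w : B → WittVector p B := fun b => WittVector.mk p fun n => if n = 0 then b else δ b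
  have w0 (b : B) : WittVector.ghostComponent 0 (w b) = b := by
    simp [WittVector.ghostComponent_apply, wittPolynomial_zero, w]
  have w1 (b : B) : WittVector.ghostComponent 1 (w b) = F b := by
    simp only [WittVector.ghostComponent_apply, wittPolynomial_one, map_add, map_mul, map_pow,
      MvPolynomial.aeval_X, map_natCast, WittVector.coeff_mk, one_ne_zero, if_true, if_false, w]
    linear_combination -hδ b
  let red : WittVector p B →+* TruncatedWittVector p 2 (B ⧸ Ideal.span {(p : B)}) :=
    (WittVector.truncate 2).comp (WittVector.map (Ideal.Quotient.mk (Ideal.span {(p : B)})))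
  have red_eq {x y : WittVector p B}
      (h0 : WittVector.ghostComponent 0 x = WittVector.ghostComponent 0 y)
      (h1 : WittVector.ghostComponent 1 x = WittVector.ghostComponent 1 y) : red x = red y :=
    truncate_map_mk_eq_of_ghostComponent_eq hflat h0 h1
  let τ : B →+* TruncatedWittVector p 2 (B ⧸ Ideal.span {(p : B)}) :=
    { toFun := fun b => red (w b)
      map_one' := (red_eq (by simp only [w0, map_one]) (by simp only [w1, map_one])).trans
        (map_one red)
      map_zero' := (red_eq (by simp only [w0, map_zero]) (by simp only [w1, map_zero])).trans
        (map_zero red)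
      map_add' := fun a b =>
        (red_eq (by simp only [w0, map_add]) (by simp only [w1, map_add])).trans
          (map_add red (w a) (w b))
      map_mul' := fun a b =>
        (red_eq (by simp only [w0, map_mul]) (by simp only [w1, map_mul])).trans
          (map_mul red (w a) (w b)) }
  have τ_coeff (b : B) (i : Fin 2) :
      (τ b).coeff i = Ideal.Quotient.mk (Ideal.span {(p : B)}) ((w b).coeff i) := by
    change (WittVector.truncate 2 (WittVector.map (Ideal.Quotient.mk _) (w b))).coeff i = _
    rw [WittVector.coeff_truncate, WittVector.map_coeff]
  refine ⟨τ, fun b => ⟨τ_coeff b 0, fun c hc => ?_⟩, fun σ hσ => ?_⟩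
  · rw [hδ]
    exact (mul_eq_mul_of_mk_span_eq hp2 (hc.trans (τ_coeff b 1))).symm
  · ext b i
    rw [τ_coeff]
    fin_cases i
    · exact (hσ b).1
    · obtain ⟨c, hc⟩ := Ideal.Quotient.mk_surjective (I := Ideal.span {(p : B)}) ((σ b).coeff 1)
      have h := (hσ b).2 c hc
      rw [hδ b] at h
      obtain ⟨d, hd⟩ := hflat (c - δ b) (by linear_combination -h)
      exact hc.symm.trans (Ideal.Quotient.eq.2 (Ideal.mem_span_singleton.2 ⟨d, hd⟩))
end

section
/- Let p be a prime and S̃ a commutative ring with (p : S̃)² = 0; write S = S̃/p·S̃ with quotient map π. Then there exists a unique ring homomorphism θ : W₂(S) → S̃ from the ring of p-typical Witt vectors of length 2 over S such that θ(x) = a^p + p·b whenever a, b ∈ S̃ satisfy π(a) = x₀ and π(b) = x₁. (This is the map θ with θ(x₀, x₁) = x̃₀^p + p·x̃₁ used in the construction of canonical Frobenius lifts.) -/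
theorem WittVector.ghostComponent_one_apply {p : ℕ} [Fact p.Prime] {R : Type*} [CommRing R]
    (x : WittVector p R) :
    WittVector.ghostComponent 1 x = x.coeff 0 ^ p + p * x.coeff 1 := by
  simp [WittVector.ghostComponent_apply, add_comm]

/-- The composite `W(R) → W(R/I) → W_n(R/I)` of reduction and truncation. -/
noncomputable def WittVector.truncateMapMk (p : ℕ) [Fact p.Prime] (n : ℕ) {R : Type*} [CommRing R]
    (I : Ideal R) : WittVector p R →+* TruncatedWittVector p n (R ⧸ I) :=
  (WittVector.truncate n).comp (WittVector.map (Ideal.Quotient.mk I))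

theorem WittVector.coeff_truncateMapMk {p : ℕ} [Fact p.Prime] {n : ℕ} {R : Type*} [CommRing R]
    (I : Ideal R) (x : WittVector p R) (i : Fin n) :
    (WittVector.truncateMapMk p n I x).coeff i = Ideal.Quotient.mk I (x.coeff i) := by
  simp [WittVector.truncateMapMk]

theorem WittVector.truncateMapMk_surjective (p : ℕ) [Fact p.Prime] (n : ℕ) {R : Type*} [CommRing R]
    (I : Ideal R) : Function.Surjective (WittVector.truncateMapMk p n I) :=
  (WittVector.truncate_surjective p n _).comp
    (WittVector.map_surjective _ Ideal.Quotient.mk_surjective)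

theorem WittVector.ker_truncateMapMk_le_ker_ghostComponent {p : ℕ} [Fact p.Prime] {R : Type*}
    [CommRing R] (hp2 : (p : R) ^ 2 = 0) :
    RingHom.ker (WittVector.truncateMapMk p 2 (Ideal.span {(p : R)})) ≤
      RingHom.ker (WittVector.ghostComponent 1 : WittVector p R →+* R) := by
  intro x hx
  have hdvd (i : Fin 2) : (p : R) ∣ x.coeff i := by
    rw [← Ideal.mem_span_singleton, ← Ideal.Quotient.eq_zero_iff_mem,
      ← WittVector.coeff_truncateMapMk, (RingHom.mem_ker).1 hx, TruncatedWittVector.coeff_zero]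
  obtain ⟨c, hc⟩ : (p : R) ∣ x.coeff 0 := hdvd 0
  obtain ⟨d, hd⟩ : (p : R) ∣ x.coeff 1 := hdvd 1
  have hpp : (p : R) ^ p = 0 := pow_eq_zero_of_le (Fact.out : p.Prime).two_le hp2
  rw [RingHom.mem_ker, WittVector.ghostComponent_one_apply, hc, hd, mul_pow, hpp, zero_mul,
    zero_add, ← mul_assoc, ← sq, hp2, zero_mul]


/-- Let `p` be a prime and `S` a commutative ring with `(p : S)² = 0`.  Then there exists a
unique ring homomorphism `θ : W₂(S/pS) → S` from the length-two `p`-typical Witt vectors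
over `S/pS` such that `θ x = a^p + p·b` whenever `a, b ∈ S` reduce to the 0-th and 1-st
Witt coefficients of `x` respectively.  (This is the map
`θ(x₀, x₁) = x̃₀^p + p·x̃₁` used in the construction of canonical Frobenius lifts.) -/
theorem exists_unique_theta_wittVector_to_lift
    (p : ℕ) [Fact p.Prime] (S : Type*) [CommRing S] (hp2 : (p : S) ^ 2 = 0) :
    ∃! θ : TruncatedWittVector p 2 (S ⧸ Ideal.span {(p : S)}) →+* S,
      ∀ (x : TruncatedWittVector p 2 (S ⧸ Ideal.span {(p : S)})) (a b : S),
        Ideal.Quotient.mk (Ideal.span {(p : S)}) a = x.coeff 0 →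
        Ideal.Quotient.mk (Ideal.span {(p : S)}) b = x.coeff 1 →
          θ x = a ^ p + p * b := by
  set I := Ideal.span {(p : S)}
  have hsurj := WittVector.truncateMapMk_surjective p 2 I
  have hinv := Function.rightInverse_surjInv hsurj
  refine ⟨RingHom.liftOfRightInverse (WittVector.truncateMapMk p 2 I) _ hinv
    ⟨WittVector.ghostComponent 1, WittVector.ker_truncateMapMk_le_ker_ghostComponent hp2⟩,
    fun x a b ha hb ↦ ?_, fun θ hθ ↦ RingHom.ext fun x ↦ ?_⟩
  · let y : WittVector p S := WittVector.mk p fun i ↦ if i = 0 then a else b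
    have hy : WittVector.truncateMapMk p 2 I y = x := by
      ext i
      rw [WittVector.coeff_truncateMapMk]
      fin_cases i
      · exact ha
      · exact hb
    rw [← hy, RingHom.liftOfRightInverse_comp_apply]
    exact WittVector.ghostComponent_one_apply y
  · obtain ⟨y, rfl⟩ := hsurj x
    rw [RingHom.liftOfRightInverse_comp_apply,
      hθ _ (y.coeff 0) (y.coeff 1) (WittVector.coeff_truncateMapMk (n := 2) I y 0).symm
        (WittVector.coeff_truncateMapMk (n := 2) I y 1).symm]
    exact (WittVector.ghostComponent_one_apply y).symm
end

section
/- Let p be a prime. Let B̃ and S̃ be commutative rings with (p : B̃)² = 0 and (p : S̃)² = 0, both flat over Z/p²Z (every element killed by p is divisible by p). Let F̃ : B̃ → B̃ be a Frobenius lift, i.e., a ring endomorphism with F̃(b) − b^p ∈ p·B̃ for all b. Write B = B̃/p·B̃ and S = S̃/p·S̃ with quotient maps π_B, π_S, and let f : B → S be a ring homomorphism. Then there exists a ring homomorphism g : B̃ → S̃ such that: (i) π_S(g(b)) = (f(π_B(b)))^p for all b ∈ B̃ (g lifts the composition of f with the Frobenius of S); (ii) for every ring homomorphism f̃ : B̃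 → S̃ with π_S ∘ f̃ = f ∘ π_B one has g(b) = f̃(F̃(b)) for all b; (iii) for every ring endomorphism G̃ : S̃ → S̃ with G̃(s) − s^p ∈ p·S̃ for all s, one has G̃(g(b)) = g(F̃(b)) for all b. (Affine version of the proposition that a Frobenius lifting on a flat W₂-scheme M̃ canonically lifts any morphism f : S → M composed with Frobenius, functorially and compatibly with all Frobenius liftings.) -/
/-- The polynomial `((x + y) ^ p - x ^ p - y ^ p) / p`, evaluated at elements of a ring. -/
def frobeniusCarry {R : Type*} [CommRing R] (p : ℕ) (x y : R) : R :=
  ∑ k ∈ Finset.Ioo 0 p, x ^ k * y ^ (p - k) * ((p.choose k / p : ℕ) : R)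

theorem add_pow_eq_frobeniusCarry {R : Type*} [CommRing R] {p : ℕ} (hp : p.Prime) (x y : R) :
    (x + y) ^ p = x ^ p + y ^ p + p * frobeniusCarry p x y :=
  add_pow_prime_eq' hp x y

theorem map_frobeniusCarry {R R' : Type*} [CommRing R] [CommRing R'] (φ : R →+* R') (p : ℕ)
    (x y : R) : φ (frobeniusCarry p x y) = frobeniusCarry p (φ x) (φ y) := by
  simp [frobeniusCarry]

theorem mul_eq_mul_of_mk_eq {R : Type*} [CommRing R] {a x y : R} (ha : a ^ 2 = 0)
    (h : Ideal.Quotient.mk (Ideal.span {a}) x = Ideal.Quotient.mk (Ideal.span {a}) y) :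
    a * x = a * y := by
  obtain ⟨c, hc⟩ := Ideal.mem_span_singleton.mp (Ideal.Quotient.eq.mp h)
  linear_combination a * hc + c * ha

theorem pow_eq_pow_of_mk_eq {R : Type*} [CommRing R] {p : ℕ} {x y : R} (hR : (p : R) ^ 2 = 0)
    (h : Ideal.Quotient.mk (Ideal.span {(p : R)}) x
      = Ideal.Quotient.mk (Ideal.span {(p : R)}) y) :
    x ^ p = y ^ p := by
  have hd := dvd_sub_pow_of_dvd_sub
    (Ideal.mem_span_singleton.mp (Ideal.Quotient.eq.mp h)) 1
  rw [pow_one, one_add_one_eq_two, hR, zero_dvd_iff] at hd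
  exact sub_eq_zero.mp hd

theorem mk_eq_mk_of_mul_eq_mul {R : Type*} [CommRing R] {a x y : R}
    (hflat : ∀ b : R, a * b = 0 → ∃ c : R, b = a * c) (h : a * x = a * y) :
    Ideal.Quotient.mk (Ideal.span {a}) x = Ideal.Quotient.mk (Ideal.span {a}) y :=
  Ideal.Quotient.eq.mpr <| Ideal.mem_span_singleton.mpr <|
    hflat _ (by rw [mul_sub, h, sub_self])

theorem mk_natCast_self_mul {R : Type*} [CommRing R] (p : ℕ) (c : R) :
    Ideal.Quotient.mk (Ideal.span {(p : R)}) (p * c) = 0 :=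
  Ideal.Quotient.eq_zero_iff_mem.mpr (Ideal.mem_span_singleton.mpr (dvd_mul_right _ c))


/-- Affine version of the proposition that a Frobenius lifting on a flat `W₂`-"scheme"
canonically lifts any morphism composed with Frobenius, functorially and compatibly with
all Frobenius liftings.

Let `p` be a prime, `B` and `S` commutative rings with `p² = 0`, both flat over `ℤ/p²ℤ`
(elements killed by `p` are multiples of `p`), `F : B → B` a Frobenius lift, and
`f : B/pB → S/pS` a ring homomorphism.  Then there is a ring homomorphism `g : B → S`
such that:
(i) `g` lifts the composition of `f` with the Frobenius of `S/pS`, i.e.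
    `g b mod p = (f (b mod p))^p`;
(ii) for every lifting `f̃ : B → S` of `f` one has `g = f̃ ∘ F`;
(iii) `g` intertwines `F` with every Frobenius lift `G` on `S`: `G (g b) = g (F b)`. -/
theorem exists_canonical_frobenius_lift_of_map
    (p : ℕ) [Fact p.Prime] (B S : Type*) [CommRing B] [CommRing S]
    (hpB : (p : B) ^ 2 = 0) (hpS : (p : S) ^ 2 = 0)
    (hBflat : ∀ b : B, (p : B) * b = 0 → ∃ c : B, b = p * c)
    (hSflat : ∀ s : S, (p : S) * s = 0 → ∃ c : S, s = p * c)
    (F : B →+* B) (hF : ∀ b : B, ∃ c : B, F b - b ^ p = p * c)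
    (f : (B ⧸ Ideal.span {(p : B)}) →+* (S ⧸ Ideal.span {(p : S)})) :
    ∃ g : B →+* S,
      (∀ b : B,
        Ideal.Quotient.mk (Ideal.span {(p : S)}) (g b)
          = (f (Ideal.Quotient.mk (Ideal.span {(p : B)}) b)) ^ p) ∧
      (∀ flift : B →+* S,
        (∀ b : B, Ideal.Quotient.mk (Ideal.span {(p : S)}) (flift b)
            = f (Ideal.Quotient.mk (Ideal.span {(p : B)}) b)) →
        ∀ b : B, g b = flift (F b)) ∧
      (∀ G : S →+* S, (∀ s : S, ∃ c : S, G s - s ^ p = p * c) →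
        ∀ b : B, G (g b) = g (F b)) := by
  have hp : p.Prime := Fact.out
  let πB := Ideal.Quotient.mk (Ideal.span {(p : B)})
  let πS := Ideal.Quotient.mk (Ideal.span {(p : S)})
  have hsurj : Function.Surjective πS := Ideal.Quotient.mk_surjective
  choose δ hδ using hF
  choose σ hσ using hsurj
  let g₀ : B → S := fun b => σ (f (πB b)) ^ p + p * σ (f (πB (δ b)))
  have hg₀ : ∀ (b d : B) (x y : S), F b = b ^ p + p * d → πS x = f (πB b) →
      πS y = f (πB d) → g₀ b = x ^ p + p * y := by
    intro b d x y hd hx hy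
    have hdd : πB (δ b) = πB d :=
      mk_eq_mk_of_mul_eq_mul hBflat (by linear_combination hd - hδ b)
    have hpow : σ (f (πB b)) ^ p = x ^ p := pow_eq_pow_of_mk_eq hpS ((hσ _).trans hx.symm)
    have hmul : (p : S) * σ (f (πB (δ b))) = p * y :=
      mul_eq_mul_of_mk_eq hpS ((hσ _).trans (by rw [hdd]; exact hy.symm))
    simp only [g₀, hpow, hmul]
  have hF' : ∀ b, F b = b ^ p + p * δ b := fun b => by linear_combination hδ b
  have hπF : ∀ b, πB (F b) = πB b ^ p := fun b => by
    have h0 : πB (p * δ b) = 0 := mk_natCast_self_mul p (δ b)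
    rw [hF', map_add, map_pow, h0, add_zero]
  let g : B →+* S :=
    { toFun := g₀
      map_one' := by
        rw [hg₀ 1 0 1 0 (by simp) (by simp) (by simp)]
        simp
      map_zero' := by
        rw [hg₀ 0 0 0 0 (by simp [hp.ne_zero]) (by simp) (by simp)]
        simp [hp.ne_zero]
      map_mul' := fun a b => by
        rw [hg₀ (a * b) (δ a * b ^ p + a ^ p * δ b) (σ (f (πB a)) * σ (f (πB b)))
          (σ (f (πB (δ a))) * σ (f (πB b)) ^ p + σ (f (πB a)) ^ p * σ (f (πB (δ b))))
          (by rw [map_mul, hF' a, hF' b]; linear_combination δ a * δ b * hpB)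
          (by simp only [map_mul, hσ]) (by simp only [map_mul, map_add, map_pow, hσ])]
        simp only [g₀]
        linear_combination (-(σ (f (πB (δ a))) * σ (f (πB (δ b))))) * hpS
      map_add' := fun a b => by
        rw [hg₀ (a + b) (δ a + δ b - frobeniusCarry p a b) (σ (f (πB a)) + σ (f (πB b)))
          (σ (f (πB (δ a))) + σ (f (πB (δ b)))
            - frobeniusCarry p (σ (f (πB a))) (σ (f (πB b))))
          (by rw [map_add, hF' a, hF' b, add_pow_eq_frobeniusCarry hp]; ring)
          (by simp only [map_add, hσ])
          (by simp only [map_add, map_sub, map_frobeniusCarry, hσ]),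
          add_pow_eq_frobeniusCarry hp]
        simp only [g₀]
        ring }
  refine ⟨g, fun b => ?_, fun φ hφ b => ?_, fun G hG b => ?_⟩
  · change πS (σ (f (πB b)) ^ p + p * σ (f (πB (δ b)))) = f (πB b) ^ p
    have h0 : πS (p * σ (f (πB (δ b)))) = 0 := mk_natCast_self_mul p _
    rw [map_add, map_pow, h0, add_zero, hσ]
  · change g₀ b = φ (F b)
    rw [hg₀ b (δ b) (φ b) (φ (δ b)) (hF' b) (hφ _) (hφ _), hF']
    simp
  · change G (σ (f (πB b)) ^ p + p * σ (f (πB (δ b)))) = g₀ (F b)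
    have hπG : ∀ s, πS (G s) = πS (s ^ p) := fun s =>
      Ideal.Quotient.eq.mpr (Ideal.mem_span_singleton.mpr (hG s))
    rw [hg₀ (F b) (F (δ b)) (σ (f (πB b)) ^ p) (σ (f (πB (δ b))) ^ p)
      (by simpa using congrArg F (hF' b))
      (by rw [hπF, map_pow, map_pow, hσ]) (by rw [hπF, map_pow, map_pow, hσ])]
    have hpow := pow_eq_pow_of_mk_eq hpS (hπG (σ (f (πB b))))
    have hmul := mul_eq_mul_of_mk_eq hpS (hπG (σ (f (πB (δ b)))))
    rw [map_add, map_pow, map_mul, map_natCast, hpow, hmul]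
end

section
/- Let p be a prime and A a commutative ring of characteristic p equipped with an F-splitting σ. Then the subset I_σ = { x ∈ W₂(A) : x₀ = 0 and σ(x₁) = 0 } of the ring W₂(A) of p-typical Witt vectors of length 2 over A is the carrier of an ideal of W₂(A). (This is the ideal I_σ = V(ker σ) defining the canonical lifting X̃(σ) modulo p² of an F-split scheme.) -/
namespace WittVector

variable {p : ℕ} [Fact p.Prime] {R : Type*} [CommRing R]

theorem verschiebung_shift_one {x : WittVector p R} (h : x.coeff 0 = 0) :
    verschiebung (x.shift 1) = x :=
  (eq_iterate_verschiebung (n := 1) (by simpa using h)).symm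

theorem add_coeff_one_of_coeff_zero_eq_zero {x y : WittVector p R} (hx : x.coeff 0 = 0)
    (hy : y.coeff 0 = 0) : (x + y).coeff 1 = x.coeff 1 + y.coeff 1 := by
  rw [← verschiebung_shift_one hx, ← verschiebung_shift_one hy, ← map_add]
  exact add_coeff_zero _ _

theorem mul_coeff_one_of_coeff_zero_eq_zero [CharP R p] (x : WittVector p R)
    {y : WittVector p R} (hy : y.coeff 0 = 0) :
    (x * y).coeff 1 = x.coeff 0 ^ p * y.coeff 1 := by
  rw [← verschiebung_shift_one hy, mul_comm, ← verschiebung_mul_frobenius]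
  rw [verschiebung_coeff_add_one _ 0, verschiebung_coeff_add_one _ 0, mul_coeff_zero,
    coeff_frobenius_charP, mul_comm]

end WittVector

/-- Let `p` be a prime and `A` a commutative ring of characteristic `p` equipped with an
`F`-splitting `σ`, i.e. an additive map `σ : A → A` with `σ 1 = 1` and
`σ (a^p * b) = a * σ b`.  Then the subset
`I_σ = { x ∈ W₂(A) : x₀ = 0 ∧ σ x₁ = 0 }` of the ring of `p`-typical Witt vectors of
length two over `A` is the carrier of an ideal of `W₂(A)`.
(This is the ideal `I_σ = V(ker σ)` defining the canonical lifting `X̃(σ)` modulo `p²`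
of an `F`-split scheme.) -/
theorem fsplitting_witt_ideal
    (p : ℕ) [Fact p.Prime] (A : Type*) [CommRing A] [CharP A p]
    (σ : A → A)
    (hadd : ∀ a b : A, σ (a + b) = σ a + σ b)
    (hone : σ 1 = 1)
    (hlin : ∀ a b : A, σ (a ^ p * b) = a * σ b) :
    ∃ I : Ideal (TruncatedWittVector p 2 A),
      ∀ x : TruncatedWittVector p 2 A,
        x ∈ I ↔ (x.coeff 0 = 0 ∧ σ (x.coeff 1) = 0) := by
  let e : A →+ A := AddMonoidHom.mk' σ hadd
  have hzero : σ 0 = 0 := map_zero e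
  refine ⟨{ carrier := {x | x.coeff 0 = 0 ∧ σ (x.coeff 1) = 0}
            add_mem' := ?_, zero_mem' := ?_, smul_mem' := ?_ }, fun _ => Iff.rfl⟩
  · intro x y hx hy
    obtain ⟨x, rfl⟩ := WittVector.truncate_surjective p 2 A x
    obtain ⟨y, rfl⟩ := WittVector.truncate_surjective p 2 A y
    simp only [Set.mem_ofPred_eq, ← map_add, WittVector.coeff_truncate, Fin.val_zero,
      Fin.val_one] at hx hy ⊢
    rw [WittVector.add_coeff_zero, WittVector.add_coeff_one_of_coeff_zero_eq_zero hx.1 hy.1,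
      hadd, hx.1, hx.2, hy.1, hy.2]
    simp
  · simp [hzero]
  · intro c x hx
    obtain ⟨c, rfl⟩ := WittVector.truncate_surjective p 2 A c
    obtain ⟨x, rfl⟩ := WittVector.truncate_surjective p 2 A x
    simp only [Set.mem_ofPred_eq, smul_eq_mul, ← map_mul, WittVector.coeff_truncate,
      Fin.val_zero, Fin.val_one] at hx ⊢
    rw [WittVector.mul_coeff_zero, WittVector.mul_coeff_one_of_coeff_zero_eq_zero c hx.1,
      hlin, hx.1, hx.2]
    simp
end

section
/- Let p be a prime and A a commutative ring of characteristic p equipped with an F-splitting σ. Let I be an ideal of the ring W₂(A) of p-typical Witt vectors of length 2 over A whose carrier is I_σ = { x ∈ W₂(A) : x₀ = 0 and σ(x₁) = 0 }. Then for every x ∈ W₂(A): x belongs to the ideal I ⊔ (p) generated by I and p if and only if x₀ = 0. (This identifies the reduction modulo p of the canonical lifting W₂(A)/I_σ with A via the 0-th Witt coefficient.) -/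
/-- Let `p` be a prime and `A` a commutative ring of characteristic `p` with an
`F`-splitting `σ`.  Let `I` be an ideal of `W₂(A)` whose carrier is
`I_σ = { x : x₀ = 0 ∧ σ x₁ = 0 }`.  Then for every `x ∈ W₂(A)`, `x` belongs to the ideal
generated by `I` and `p` if and only if `x₀ = 0`.  (This identifies the reduction modulo
`p` of the canonical lifting `W₂(A)/I_σ` with `A` via the 0-th Witt coefficient.) -/
theorem fsplitting_witt_sup_p_eq_coeff_zero
    (p : ℕ) [Fact p.Prime] (A : Type*) [CommRing A] [CharP A p]
    (σ : A → A)
    (hadd : ∀ a b : A, σ (a + b) = σ a + σ b)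
    (hone : σ 1 = 1)
    (hlin : ∀ a b : A, σ (a ^ p * b) = a * σ b)
    (I : Ideal (TruncatedWittVector p 2 A))
    (hI : ∀ x : TruncatedWittVector p 2 A,
      x ∈ I ↔ (x.coeff 0 = 0 ∧ σ (x.coeff 1) = 0)) :
    ∀ x : TruncatedWittVector p 2 A,
      x ∈ I ⊔ Ideal.span {(p : TruncatedWittVector p 2 A)} ↔ x.coeff 0 = 0 := by
  intro x
  constructor
  · intro hx
    obtain ⟨y, hy, z, hz, rfl⟩ := Submodule.mem_sup.mp hx
    obtain ⟨c, rfl⟩ := Ideal.mem_span_singleton'.mp hz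
    have hy0 := ((hI y).mp hy).1
    obtain ⟨y, rfl⟩ := WittVector.truncate_surjective p 2 A y
    obtain ⟨c, rfl⟩ := WittVector.truncate_surjective p 2 A c
    rw [WittVector.coeff_truncate] at hy0
    rw [← map_natCast (WittVector.truncate (p := p) (R := A) 2), ← map_mul, ← map_add,
      WittVector.coeff_truncate]
    simp only [Fin.val_zero] at hy0 ⊢
    rw [WittVector.add_coeff_zero, hy0, WittVector.mul_charP_coeff_zero, add_zero]
  · intro hx
    set b := x.coeff 1 with hb
    set t : WittVector p A := WittVector.teichmuller p (σ b)
    set u : WittVector p A := WittVector.teichmuller p b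
    have hxu : x = WittVector.truncate 2 (WittVector.verschiebung u) := by
      ext i
      rw [WittVector.coeff_truncate]
      fin_cases i
      · simpa [WittVector.verschiebung_coeff_zero] using hx
      · exact hb.symm.trans <| ((WittVector.verschiebung_coeff_succ u 0).trans
          (WittVector.teichmuller_coeff_zero p b)).symm
    have hdecomp : x = WittVector.truncate 2 (WittVector.verschiebung
        (u - WittVector.frobenius t)) + WittVector.truncate 2 t * p := by
      rw [hxu, ← map_natCast (WittVector.truncate (p := p) (R := A) 2), ← map_mul, ← map_add,
        ← WittVector.verschiebung_frobenius, ← map_add, sub_add_cancel]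
    rw [hdecomp]
    refine Submodule.add_mem_sup ((hI _).mpr ⟨?_, ?_⟩)
      (Ideal.mem_span_singleton'.mpr ⟨_, rfl⟩)
    · rw [WittVector.coeff_truncate]
      exact WittVector.verschiebung_coeff_zero _
    · have hcoeff : (WittVector.verschiebung (u - WittVector.frobenius t)).coeff 1
          = b - σ b ^ p := by
        rw [show (1 : ℕ) = 0 + 1 from rfl, WittVector.verschiebung_coeff_succ,
          show (u - WittVector.frobenius t).coeff 0 = u.coeff 0 - (WittVector.frobenius t).coeff 0
            from map_sub WittVector.constantCoeff u (WittVector.frobenius t),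
          WittVector.coeff_frobenius_charP,
          WittVector.teichmuller_coeff_zero, WittVector.teichmuller_coeff_zero]
      have hpow : σ (σ b ^ p) = σ b := by simpa [hone] using hlin (σ b) 1
      rw [WittVector.coeff_truncate, Fin.val_one, hcoeff]
      have hsum := hadd (b - σ b ^ p) (σ b ^ p)
      rw [sub_add_cancel, hpow] at hsum
      exact left_eq_add.mp (by rwa [add_comm] at hsum)
end

section
/- Let p be a prime and A a commutative ring of characteristic p equipped with an F-splitting σ. Let I be an ideal of the ring W₂(A) of p-typical Witt vectors of length 2 over A whose carrier is I_σ = { x ∈ W₂(A) : x₀ = 0 and σ(x₁) = 0 }. Then for every x ∈ W₂(A): p·x ∈ I if and only if x₀ = 0. (Combined with the identification of the reduction mod p, this says that the canonical lifting W₂(A)/I_σ is flat over Z/p²Z: its p-torsion equals its p-multiples.) -/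
/-- Let `p` be a prime and `A` a commutative ring of characteristic `p` with an
`F`-splitting `σ`.  Let `I` be an ideal of `W₂(A)` whose carrier is
`I_σ = { x : x₀ = 0 ∧ σ x₁ = 0 }`.  Then for every `x ∈ W₂(A)`, `p·x ∈ I` if and only if
`x₀ = 0`.  (Combined with the identification of the reduction mod `p`, this says that the
canonical lifting `W₂(A)/I_σ` is flat over `ℤ/p²ℤ`: its `p`-torsion equals its
`p`-multiples.) -/
theorem fsplitting_witt_p_mul_mem_iff_coeff_zero
    (p : ℕ) [Fact p.Prime] (A : Type*) [CommRing A] [CharP A p]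
    (σ : A → A)
    (hadd : ∀ a b : A, σ (a + b) = σ a + σ b)
    (hone : σ 1 = 1)
    (hlin : ∀ a b : A, σ (a ^ p * b) = a * σ b)
    (I : Ideal (TruncatedWittVector p 2 A))
    (hI : ∀ x : TruncatedWittVector p 2 A,
      x ∈ I ↔ (x.coeff 0 = 0 ∧ σ (x.coeff 1) = 0)) :
    ∀ x : TruncatedWittVector p 2 A,
      (p : TruncatedWittVector p 2 A) * x ∈ I ↔ x.coeff 0 = 0 := by
  intro x
  obtain ⟨w, rfl⟩ := WittVector.truncate_surjective p 2 A x
  rw [← map_natCast (WittVector.truncate (p := p) (R := A) 2) p, ← map_mul, mul_comm, hI]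
  simp only [WittVector.coeff_truncate, Fin.val_zero, Fin.val_one]
  have hσ : σ (w.coeff 0 ^ p) = w.coeff 0 := by simpa [hone] using hlin (w.coeff 0) 1
  rw [WittVector.mul_charP_coeff_zero, WittVector.mul_charP_coeff_succ w 0, hσ]
  exact and_iff_right rfl
end

section
/- Let p be a prime, m ≥ 1, and A a commutative ring of characteristic p. Let σ : W_m(A) → A be a quasi-F-splitting of level m. Then the image of the kernel of σ under Verschiebung, namely the subset V(ker σ) = { z ∈ W_{m+1}(A) : z₀ = 0 and σ(w) = 0, where w ∈ W_m(A) is the Witt vector with coefficients w_i = z_{i+1} for 0 ≤ i ≤ m−1 }, is the carrier of an ideal of W_{m+1}(A). -/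
/-- Dropping the zeroth coefficient of a truncated Verschiebung recovers the truncation. -/
theorem TruncatedWittVector.mk_coeff_succ_truncate_verschiebung
    (p : ℕ) [Fact p.Prime] (m : ℕ) {A : Type*} [CommRing A] (w : WittVector p A) :
    TruncatedWittVector.mk p (fun i : Fin m =>
        (WittVector.truncate (m + 1) (WittVector.verschiebung w)).coeff i.succ)
      = WittVector.truncate m w := by
  ext i
  simp [WittVector.coeff_truncate, WittVector.verschiebung_coeff_succ]

/-- A truncated Witt vector with vanishing zeroth coefficient is a truncated Verschiebung. -/
theorem TruncatedWittVector.exists_truncate_verschiebung_eq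
    (p : ℕ) [Fact p.Prime] (m : ℕ) {A : Type*} [CommRing A]
    (z : TruncatedWittVector p (m + 1) A) (hz : z.coeff 0 = 0) :
    ∃ w : WittVector p A, WittVector.truncate (m + 1) (WittVector.verschiebung w) = z := by
  refine ⟨(TruncatedWittVector.mk p (fun i : Fin m => z.coeff i.succ)).out, ?_⟩
  ext i
  refine Fin.cases ?_ (fun j => ?_) i
  · simp [WittVector.coeff_truncate, hz]
  · simp [WittVector.coeff_truncate]

/-- The truncation of the Frobenius of a Witt vector over a ring of characteristic `p`. -/
theorem WittVector.truncate_frobenius_charP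
    (p : ℕ) [Fact p.Prime] (m : ℕ) {A : Type*} [CommRing A] [CharP A p] (c : WittVector p A) :
    WittVector.truncate m (WittVector.frobenius c)
      = TruncatedWittVector.mk p (fun i => ((WittVector.truncate m c).coeff i) ^ p) := by
  ext i
  simp [WittVector.coeff_truncate, WittVector.coeff_frobenius_charP]


/-- Let `p` be a prime, `m ≥ 1`, and `A` a commutative ring of characteristic `p`.  Let
`σ : Wₘ(A) → A` be a quasi-`F`-splitting of level `m`: an additive map with `σ 1 = 1` and
`σ (F x · y) = x₀ · σ y`, where `F x` is the Witt vector with coefficients `xᵢ^p`.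
Then the image of `ker σ` under Verschiebung, namely the subset
`V(ker σ) = { z ∈ W_{m+1}(A) : z₀ = 0 ∧ σ (z₁, …, z_m) = 0 }`, is the carrier of an ideal
of `W_{m+1}(A)`. -/
theorem quasiFSplitting_verschiebung_ker_ideal
    (p : ℕ) [Fact p.Prime] (m : ℕ) (hm : 0 < m)
    (A : Type*) [CommRing A] [CharP A p]
    (σ : TruncatedWittVector p m A → A)
    (hadd : ∀ x y : TruncatedWittVector p m A, σ (x + y) = σ x + σ y)
    (hone : σ 1 = 1)
    (hF : ∀ x y : TruncatedWittVector p m A,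
      σ (TruncatedWittVector.mk p (fun i => (x.coeff i) ^ p) * y)
        = x.coeff ⟨0, hm⟩ * σ y) :
    ∃ I : Ideal (TruncatedWittVector p (m + 1) A),
      ∀ z : TruncatedWittVector p (m + 1) A,
        z ∈ I ↔ (z.coeff 0 = 0 ∧
          σ (TruncatedWittVector.mk p (fun i : Fin m => z.coeff i.succ)) = 0) := by
  have hzero : σ 0 = 0 := by simpa using hadd 0 0
  have mem_iff : ∀ z : TruncatedWittVector p (m + 1) A,
      (z.coeff 0 = 0 ∧ σ (TruncatedWittVector.mk p (fun i : Fin m => z.coeff i.succ)) = 0) ↔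
        ∃ w : WittVector p A, WittVector.truncate (m + 1) (WittVector.verschiebung w) = z ∧
          σ (WittVector.truncate m w) = 0 := by
    intro z
    constructor
    · rintro ⟨h0, hσ⟩
      obtain ⟨w, rfl⟩ := TruncatedWittVector.exists_truncate_verschiebung_eq p m z h0
      rw [TruncatedWittVector.mk_coeff_succ_truncate_verschiebung] at hσ
      exact ⟨w, rfl, hσ⟩
    · rintro ⟨w, rfl, hσ⟩
      rw [TruncatedWittVector.mk_coeff_succ_truncate_verschiebung]
      exact ⟨by simp [WittVector.coeff_truncate], hσ⟩
  refine ⟨{ carrier := {z | ∃ w : WittVector p A,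
              WittVector.truncate (m + 1) (WittVector.verschiebung w) = z ∧
                σ (WittVector.truncate m w) = 0}
            zero_mem' := ⟨0, by simp, by simpa using hzero⟩
            add_mem' := ?_
            smul_mem' := ?_ }, fun z => (mem_iff z).symm⟩
  · rintro _ _ ⟨v, rfl, hv⟩ ⟨w, rfl, hw⟩
    exact ⟨v + w, by simp, by rw [map_add, hadd, hv, hw, add_zero]⟩
  · rintro c _ ⟨w, rfl, hw⟩
    obtain ⟨c, rfl⟩ := WittVector.truncate_surjective p (m + 1) A c
    refine ⟨w * WittVector.frobenius c, ?_, ?_⟩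
    · rw [WittVector.verschiebung_mul_frobenius, map_mul, smul_eq_mul, mul_comm]
    · rw [map_mul, mul_comm, WittVector.truncate_frobenius_charP, hF, hw, mul_zero]
end

section
/- Let p be a prime, m ≥ 1, and A a commutative ring of characteristic p. Let σ : W_m(A) → A be a quasi-F-splitting of level m, and let I be an ideal of W_{m+1}(A) whose carrier is V(ker σ) = { z ∈ W_{m+1}(A) : z₀ = 0 and σ(w) = 0, where w ∈ W_m(A) has coefficients w_i = z_{i+1} }. Then: (a) (p : W_{m+1}(A))² ∈ I; (b) for every z ∈ W_{m+1}(A), p·z ∈ I if and only if z₀ = 0; (c) for every z ∈ W_{m+1}(A), z belongs to the ideal I ⊔ (p) generated by I and p if and only if z₀ = 0. (Hence the quotient W_{m+1}(A)/V(ker σ) is a flat Z/p²Z-algebra whose reduction modulo p is A: Yobuko's canonical lifting modulo p² of a quasi-F-split ring.) -/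
namespace WittVector

variable {p : ℕ} [Fact p.Prime] {A : Type*} [CommRing A]

theorem mk_coeff_succ_truncate_verschiebung (m : ℕ) (w : WittVector p A) :
    TruncatedWittVector.mk p
      (fun i : Fin m => (truncate (m + 1) (verschiebung w)).coeff i.succ) = truncate m w := by
  ext i
  rw [TruncatedWittVector.coeff_mk, coeff_truncate, coeff_truncate, Fin.val_succ,
    verschiebung_coeff_succ]

theorem coeff_zero_truncate_verschiebung (m : ℕ) (w : WittVector p A) :
    (truncate (m + 1) (verschiebung w)).coeff 0 = 0 := by
  rw [coeff_truncate, Fin.val_zero, verschiebung_coeff_zero]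

theorem exists_truncate_verschiebung_eq {m : ℕ} {z : TruncatedWittVector p (m + 1) A}
    (hz : z.coeff 0 = 0) : ∃ w : WittVector p A, truncate (m + 1) (verschiebung w) = z := by
  refine ⟨mk p fun n => z.out.coeff (n + 1), ?_⟩
  ext i
  rw [coeff_truncate]
  refine Fin.cases ?_ (fun j => ?_) i
  · rw [hz, Fin.val_zero, verschiebung_coeff_zero]
  · rw [Fin.val_succ, verschiebung_coeff_succ, coeff_mk, ← Fin.val_succ,
      TruncatedWittVector.coeff_out]

theorem truncate_frobenius [CharP A p] (m : ℕ) (x : WittVector p A) :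
    truncate m (frobenius x) =
      TruncatedWittVector.mk p fun i => ((truncate m x).coeff i) ^ p := by
  ext i
  rw [coeff_truncate, coeff_frobenius_charP, TruncatedWittVector.coeff_mk, coeff_truncate]

theorem natCast_mul_truncate [CharP A p] (m : ℕ) (x : WittVector p A) :
    (p : TruncatedWittVector p m A) * truncate m x =
      truncate m (verschiebung (frobenius x)) := by
  rw [verschiebung_frobenius, map_mul, map_natCast, mul_comm]

end WittVector

open WittVector

/-- Let `p` be a prime, `m ≥ 1`, and `A` a commutative ring of characteristic `p`.  Let
`σ : Wₘ(A) → A` be a quasi-`F`-splitting of level `m`, and let `I` be an ideal of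
`W_{m+1}(A)` with carrier `V(ker σ) = { z : z₀ = 0 ∧ σ (z₁, …, z_m) = 0 }`.  Then:
(a) `(p : W_{m+1}(A))² ∈ I`;
(b) for every `z`, `p·z ∈ I ↔ z₀ = 0`;
(c) for every `z`, `z ∈ I ⊔ (p) ↔ z₀ = 0`.
(Hence `W_{m+1}(A)/V(ker σ)` is a flat `ℤ/p²ℤ`-algebra with reduction `A` modulo `p`:
Yobuko's canonical lifting modulo `p²` of a quasi-`F`-split ring.) -/
theorem quasiFSplitting_canonical_lifting_flat
    (p : ℕ) [Fact p.Prime] (m : ℕ) (hm : 0 < m)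
    (A : Type*) [CommRing A] [CharP A p]
    (σ : TruncatedWittVector p m A → A)
    (hadd : ∀ x y : TruncatedWittVector p m A, σ (x + y) = σ x + σ y)
    (hone : σ 1 = 1)
    (hF : ∀ x y : TruncatedWittVector p m A,
      σ (TruncatedWittVector.mk p (fun i => (x.coeff i) ^ p) * y)
        = x.coeff ⟨0, hm⟩ * σ y)
    (I : Ideal (TruncatedWittVector p (m + 1) A))
    (hI : ∀ z : TruncatedWittVector p (m + 1) A,
      z ∈ I ↔ (z.coeff 0 = 0 ∧
        σ (TruncatedWittVector.mk p (fun i : Fin m => z.coeff i.succ)) = 0)) :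
    ((p : TruncatedWittVector p (m + 1) A) ^ 2 ∈ I) ∧
    (∀ z : TruncatedWittVector p (m + 1) A,
      (p : TruncatedWittVector p (m + 1) A) * z ∈ I ↔ z.coeff 0 = 0) ∧
    (∀ z : TruncatedWittVector p (m + 1) A,
      z ∈ I ⊔ Ideal.span {(p : TruncatedWittVector p (m + 1) A)} ↔ z.coeff 0 = 0) := by
  have mem_iff (w : WittVector p A) :
      truncate (m + 1) (verschiebung w) ∈ I ↔ σ (truncate m w) = 0 := by
    rw [hI, mk_coeff_succ_truncate_verschiebung,
      and_iff_right (coeff_zero_truncate_verschiebung m w)]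
  have σ_frobenius (x : WittVector p A) :
      σ (truncate m (frobenius x)) = x.coeff 0 := by
    rw [truncate_frobenius, ← mul_one (TruncatedWittVector.mk p _), hF, hone, mul_one,
      coeff_truncate]
  have p_mul_mem_iff (z : TruncatedWittVector p (m + 1) A) :
      (p : TruncatedWittVector p (m + 1) A) * z ∈ I ↔ z.coeff 0 = 0 := by
    obtain ⟨x, rfl⟩ := truncate_surjective p (m + 1) A z
    rw [natCast_mul_truncate, mem_iff, σ_frobenius, coeff_truncate, Fin.val_zero]
  refine ⟨?_, p_mul_mem_iff, fun z => ⟨fun hz => ?_, fun hz => ?_⟩⟩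
  · rw [pow_two, p_mul_mem_iff, ← map_natCast (truncate (p := p) (R := A) (m + 1)) p,
      coeff_truncate, Fin.val_zero, coeff_p_zero]
  · obtain ⟨x, hx, y, hy, rfl⟩ := Submodule.mem_sup.mp hz
    obtain ⟨a, rfl⟩ := Ideal.mem_span_singleton'.mp hy
    obtain ⟨a, rfl⟩ := truncate_surjective p (m + 1) A a
    obtain ⟨w, rfl⟩ := exists_truncate_verschiebung_eq ((hI x).mp hx).1
    rw [mul_comm, natCast_mul_truncate, ← map_add, ← map_add, coeff_zero_truncate_verschiebung]
  · obtain ⟨w, rfl⟩ := exists_truncate_verschiebung_eq hz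
    let t := teichmuller p (σ (truncate m w))
    have ht : truncate (m + 1) (verschiebung (w - frobenius t)) ∈ I := by
      have h := hadd (truncate m (w - frobenius t)) (truncate m (frobenius t))
      rw [← map_add, sub_add_cancel, σ_frobenius, teichmuller_coeff_zero] at h
      exact (mem_iff _).mpr (right_eq_add.mp h)
    refine Submodule.mem_sup.mpr ⟨_, ht, truncate (m + 1) (verschiebung (frobenius t)), ?_, ?_⟩
    · rw [← natCast_mul_truncate]
      exact Ideal.mul_mem_right _ _ (Ideal.mem_span_singleton_self _)
    · rw [← map_add, ← map_add, sub_add_cancel]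
end

section
/- Let p be a prime and A a commutative ring of characteristic p. For all a, b ∈ A there exists c ∈ W(A) such that teichmuller(a + b)^p = teichmuller(a)^p + teichmuller(b)^p + p·c. (The p-th power of the Teichmüller lift is additive modulo p; consequently a ↦ [a]^p mod p induces a ring homomorphism ρ : A → W_m(A)/p, giving the mod-p Witt vectors their O_X-algebra structure.) -/
/-- In characteristic `p`, the Frobenius raises Teichmüller lifts to the `p`-th power. -/
theorem WittVector.frobenius_teichmuller_of_charP
    (p : ℕ) [Fact p.Prime] {A : Type*} [CommRing A] [CharP A p] (a : A) :
    WittVector.frobenius (WittVector.teichmuller p a) = WittVector.teichmuller p a ^ p := by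
  rw [WittVector.frobenius_eq_map_frobenius, WittVector.map_teichmuller, frobenius_def, map_pow]

/-- If the zeroth coefficient of `x` vanishes, then `p` divides the Frobenius of `x`. -/
theorem WittVector.dvd_frobenius_of_coeff_zero_eq_zero
    {p : ℕ} [Fact p.Prime] {A : Type*} [CommRing A] {x : WittVector p A} (hx : x.coeff 0 = 0) :
    (p : WittVector p A) ∣ WittVector.frobenius x := by
  refine ⟨x.shift 1, ?_⟩
  have h : x = WittVector.verschiebung (x.shift 1) := by
    simpa using WittVector.eq_iterate_verschiebung (x := x) (n := 1) (by simp [hx])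
  conv_lhs => rw [h]
  rw [WittVector.frobenius_verschiebung, mul_comm]

/-- Let `p` be a prime and `A` a commutative ring of characteristic `p`.  For all
`a, b ∈ A` there exists `c ∈ W(A)` such that
`teichmuller (a + b) ^ p = teichmuller a ^ p + teichmuller b ^ p + p·c`.
(The `p`-th power of the Teichmüller lift is additive modulo `p`; hence
`a ↦ [a]^p mod p` induces a ring homomorphism `ρ : A → Wₘ(A)/p`.) -/
theorem wittVector_teichmuller_pow_add_mod_p
    (p : ℕ) [hp : Fact p.Prime] (A : Type*) [CommRing A] [CharP A p]
    (a b : A) :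
    ∃ c : WittVector p A,
      (WittVector.teichmuller p (a + b)) ^ p
        = (WittVector.teichmuller p a) ^ p + (WittVector.teichmuller p b) ^ p + p * c := by
  have hx : WittVector.constantCoeff (WittVector.teichmuller p (a + b)
      - WittVector.teichmuller p a - WittVector.teichmuller p b) = 0 := by
    rw [map_sub, map_sub]
    simp
  rw [WittVector.constantCoeff_apply] at hx
  obtain ⟨c, hc⟩ := WittVector.dvd_frobenius_of_coeff_zero_eq_zero hx
  refine ⟨c, ?_⟩
  simp only [map_sub, WittVector.frobenius_teichmuller_of_charP] at hc
  rw [← hc]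
  ring
end

section
/- Let p be a prime and R a commutative ring. Let A and B be commutative R-algebras with (p : B)² = 0, and let φ : A → B be an R-algebra homomorphism such that every element in the image of φ can be written as b^p + p·c for some b, c ∈ B (φ lifts a map factoring through Frobenius). Then for every x ∈ A whose universal Kähler differential is divisible by p, i.e., D_{A/R}(x) = p·ω for some ω ∈ Ω¹_{A/R}, one has D_{B/R}(φ(x)) = 0 in Ω¹_{B/R}. (This is the computation showing that a lifting of the relative Frobenius carries the relative Witt vectors W_{X̃'} — functions whose differential is divisible by p — into the horizontal functions H⁰_dR(X̃/S̃), i.e., functions with vanishing differential.) -/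
/-- If `p² = 0` in `B` and `y = b ^ p + p * c`, then `p` annihilates `D y`. -/
theorem KaehlerDifferential.nsmul_D_pow_add_mul_eq_zero {R B : Type*} [CommRing R] [CommRing B]
    [Algebra R B] {p : ℕ} (hB : (p : B) ^ 2 = 0) (b c : B) :
    p • KaehlerDifferential.D R B (b ^ p + p * c) = 0 := by
  have hΩ (η : KaehlerDifferential R B) : p • p • η = 0 := by
    rw [← Nat.cast_smul_eq_nsmul B p (p • η), ← Nat.cast_smul_eq_nsmul B p η, smul_smul,
      ← pow_two, hB, zero_smul]
  rw [map_add, Derivation.leibniz_pow, ← nsmul_eq_mul, map_nsmul, smul_add, hΩ, hΩ, add_zero]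

/-- Let `p` be a prime and `R` a commutative ring.  Let `A` and `B` be commutative
`R`-algebras with `(p : B)² = 0`, and let `φ : A → B` be an `R`-algebra homomorphism such
that every element in the image of `φ` can be written as `b^p + p·c` with `b, c ∈ B`
(`φ` lifts a map factoring through Frobenius).  Then for every `x ∈ A` whose universal
Kähler differential is divisible by `p`, i.e. `D_{A/R} x = p·ω` for some
`ω ∈ Ω¹_{A/R}`, one has `D_{B/R} (φ x) = 0` in `Ω¹_{B/R}`.
(A lifting of the relative Frobenius carries the relative Witt vectors into the horizontal
functions.) -/
theorem kaehlerDifferential_map_eq_zero_of_frobenius_lift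
    (p : ℕ) (hp : p.Prime) (R A B : Type*)
    [CommRing R] [CommRing A] [CommRing B] [Algebra R A] [Algebra R B]
    (hB : (p : B) ^ 2 = 0)
    (φ : A →ₐ[R] B)
    (hφ : ∀ a : A, ∃ b c : B, φ a = b ^ p + p * c)
    (x : A) (ω : KaehlerDifferential R A)
    (hx : KaehlerDifferential.D R A x = p • ω) :
    KaehlerDifferential.D R B (φ x) = 0 := by
  let : Algebra A B := φ.toAlgebra
  have : IsScalarTower R A B := IsScalarTower.of_algebraMap_eq fun r => (φ.commutes r).symm
  have hD (a : A) : KaehlerDifferential.map R R A B (KaehlerDifferential.D R A a) =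
      KaehlerDifferential.D R B (φ a) := KaehlerDifferential.map_D R R A B a
  have hmap (η : KaehlerDifferential R A) : p • KaehlerDifferential.map R R A B η = 0 := by
    have hη : η ∈ Submodule.span A (Set.range (KaehlerDifferential.D R A)) := by
      rw [KaehlerDifferential.span_range_derivation]
      exact Submodule.mem_top
    induction hη using Submodule.span_induction with
    | mem _ h =>
      obtain ⟨a, rfl⟩ := h
      obtain ⟨b, c, h⟩ := hφ a
      rw [hD, h, KaehlerDifferential.nsmul_D_pow_add_mul_eq_zero hB]
    | zero => rw [map_zero, smul_zero]
    | add _ _ _ _ h₁ h₂ => rw [map_add, smul_add, h₁, h₂, add_zero]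
    | smul a _ _ h => rw [map_smul, smul_comm, h, smul_zero]
  rw [← hD, hx, map_nsmul, hmap]
end
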